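/- arXiv:0912.3028 — 2 statements merged into one kernel-verified Lean document; each statement's English description precedes it below -/
import Mathlib

section
/- Let (B_t)_{t≥0} be a standard Brownian motion on a probability space (Ω, 𝒜, P). Let V₀ > H > 0, σ > 0, μ ∈ ℝ and T > 0, and consider the geometric Brownian motion V*_t = V₀·exp((μ − σ²/2)·t + σ·B_t). Then the probability that V* never touches the constant barrier H from above on [0, T] equals P(∀ t ∈ [0, T], V*_t > H) = Φ(d₁) − (V₀/H)^{1 − 2μ/σ²}·Φ(d₂), where d₁ = (log(V₀/H) + (μ − σ²/2)·T)/(σ·√T) and d₂ = (−log(V₀/H) + (μ − σ²/2)·T)/(σ·√T). (This is the Black–Cox survival probability (survprob2), with μ = r − q*.) -/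
open MeasureTheory ProbabilityTheory

/-- The standard normal cumulative distribution function
`Φ(x) = ∫_{-∞}^x (1/√(2π))·exp(-u²/2) du`. -/
noncomputable def stdNormalCDF (x : ℝ) : ℝ :=
  (ProbabilityTheory.gaussianReal 0 1 (Set.Iic x)).toReal

lemma bc_cdf_eq (c s a : ℝ) (hs : 0 < s) :
    (gaussianReal c (Real.toNNReal s) (Set.Iic a)).toReal = stdNormalCDF ((a - c) / √s) := by
  unfold stdNormalCDF
  have hss : 0 < √s := Real.sqrt_pos.2 hs
  have h : gaussianReal c (Real.toNNReal s) = (gaussianReal 0 1).map (fun x => √s * x + c) := by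
    have : (fun x : ℝ => √s * x + c) = (fun x => x + c) ∘ (fun x => √s * x) := rfl
    rw [this, ← Measure.map_map (by fun_prop) (by fun_prop), gaussianReal_map_const_mul,
      gaussianReal_map_add_const]
    congr 1
    · simp
    · ext
      simp [hs.le]
  rw [h, Measure.map_apply (by fun_prop) measurableSet_Iic]
  congr 2
  ext x
  simp only [Set.mem_preimage, Set.mem_Iic]
  rw [le_div_iff₀ hss]
  constructor <;> intro h <;> linarith

lemma bc_cdf_Ioi (s a : ℝ) (hs : 0 < s) :
    (gaussianReal 0 (Real.toNNReal s) (Set.Ioi a)).toReal = stdNormalCDF ((-a) / √s) := by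
  have hv : Real.toNNReal s ≠ 0 := by simpa using hs
  have := nullSingletonClass_gaussianReal (μ := 0) hv
  have h1 := bc_cdf_eq 0 s (-a) hs
  rw [sub_zero] at h1
  rw [← h1]
  have h2 : gaussianReal 0 (Real.toNNReal s) = (gaussianReal 0 (Real.toNNReal s)).map (fun x => -x) := by
    rw [gaussianReal_map_neg]; simp
  rw [h2, Measure.map_apply (by fun_prop) measurableSet_Ioi, ← h2]
  have : (fun x : ℝ => -x) ⁻¹' Set.Ioi a = Set.Iio (-a) := by
    ext x; simp only [Set.mem_preimage, Set.mem_Ioi, Set.mem_Iio]; constructor <;> intro h <;> linarith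
  rw [this, measure_congr Iio_ae_eq_Iic]

lemma bc_cdf_nonneg (x : ℝ) : 0 ≤ stdNormalCDF x := ENNReal.toReal_nonneg

lemma bc_cdf_le_one (x : ℝ) : stdNormalCDF x ≤ 1 := by
  unfold stdNormalCDF
  exact measureReal_le_one

lemma bc_cdf_lip_aux (a b : ℝ) (hab : a ≤ b) :
    stdNormalCDF b - stdNormalCDF a ≤ b - a ∧ stdNormalCDF a ≤ stdNormalCDF b := by
  have hmono : stdNormalCDF a ≤ stdNormalCDF b := by
    unfold stdNormalCDF
    exact measureReal_mono (Set.Iic_subset_Iic.2 hab)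
  refine ⟨?_, hmono⟩
  have h0 : stdNormalCDF b ≤ stdNormalCDF a + (gaussianReal 0 1).real (Set.Ioc a b) := by
    unfold stdNormalCDF
    rw [← Set.Iic_union_Ioc_eq_Iic hab]
    exact measureReal_union_le _ _
  have h1 : gaussianReal 0 1 (Set.Ioc a b) ≤ ENNReal.ofReal (b - a) := by
    rw [gaussianReal_apply 0 one_ne_zero]
    calc ∫⁻ x in Set.Ioc a b, gaussianPDF 0 1 x ≤ ∫⁻ x in Set.Ioc a b, 1 := by
          apply lintegral_mono
          intro x
          simp only [gaussianPDF, ENNReal.ofReal_le_one]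
          rw [gaussianPDFReal_def]
          simp only [NNReal.coe_one, mul_one, sub_zero]
          have : 1 ≤ √(2 * Real.pi) := by
            rw [Real.one_le_sqrt]; nlinarith [Real.pi_gt_three]
          have h3 : (√(2 * Real.pi))⁻¹ ≤ 1 := inv_le_one_of_one_le₀ this
          have h4 : Real.exp (-x ^ 2 / 2) ≤ 1 := Real.exp_le_one_iff.2 (by nlinarith [sq_nonneg x])
          exact mul_le_one₀ h3 (Real.exp_pos _).le h4
      _ = ENNReal.ofReal (b - a) := by simp
  have h2 : (gaussianReal 0 1).real (Set.Ioc a b) ≤ b - a :=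
    ENNReal.toReal_le_of_le_ofReal (by linarith) h1
  linarith

lemma bc_cdf_lip (a b : ℝ) : |stdNormalCDF a - stdNormalCDF b| ≤ |a - b| := by
  rcases le_total a b with h | h
  · have := bc_cdf_lip_aux a b h
    rw [abs_sub_comm, abs_sub_comm a, abs_of_nonneg (by linarith), abs_of_nonneg (by linarith)]
    exact this.1
  · have := bc_cdf_lip_aux b a h
    rw [abs_of_nonneg (by linarith), abs_of_nonneg (by linarith)]
    exact this.1

lemma bc_cdf_continuous : Continuous stdNormalCDF := by
  have : LipschitzWith 1 stdNormalCDF := LipschitzWith.of_dist_le_mul (by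
    intro a b; simpa [Real.dist_eq] using bc_cdf_lip a b)
  exact this.continuous

/-- survival function. -/
noncomputable def bcU (m s y : ℝ) : ℝ :=
  stdNormalCDF ((y + m * s) / √s) - Real.exp (-2 * m * y) * stdNormalCDF ((-y + m * s) / √s)

/-- antisymmetrized payoff. -/
noncomputable def bcG (m y : ℝ) : ℝ := if 0 < y then 1 else - Real.exp (-2 * m * y)

lemma bcG_meas (m : ℝ) : Measurable (bcG m) := by
  unfold bcG
  exact Measurable.ite measurableSet_Ioi measurable_const (by fun_prop)

lemma bcG_bound (m y : ℝ) : |bcG m y| ≤ 1 + Real.exp (-2 * m * y) := by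
  unfold bcG
  have := Real.exp_pos (-2 * m * y)
  split_ifs
  · rw [abs_one]; linarith
  · rw [abs_neg, abs_of_pos this]; linarith

lemma bcG_integrable (m y : ℝ) (v : NNReal) :
    Integrable (fun w => bcG m (y + w)) (gaussianReal 0 v) := by
  have h : Integrable (fun w => 1 + Real.exp (-2 * m * y) * Real.exp (-2 * m * w)) (gaussianReal 0 v) :=
    (integrable_const _).add ((integrable_exp_mul_gaussianReal (-2 * m)).const_mul _)
  refine h.mono' ((bcG_meas m).comp (by fun_prop)).aestronglyMeasurable ?_
  filter_upwards with w
  rw [Real.norm_eq_abs, ← Real.exp_add]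
  convert bcG_bound m (y + w) using 3
  ring

lemma bc_tilt (m s : ℝ) (hs : 0 < s) (w : ℝ) :
    gaussianPDFReal 0 (Real.toNNReal s) w * Real.exp (-2 * m * (m * s + w)) =
      gaussianPDFReal (-2 * m * s) (Real.toNNReal s) w := by
  rw [gaussianPDFReal_def, gaussianPDFReal_def]
  simp only [Real.coe_toNNReal s hs.le]
  rw [mul_assoc, ← Real.exp_add]
  congr 2
  field_simp
  ring

lemma bc_gauss (m s y : ℝ) (hs : 0 < s) :
    ∫ w, bcG m (y + m * s + w) ∂(gaussianReal 0 (Real.toNNReal s)) = bcU m s y := by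
  have hv : Real.toNNReal s ≠ 0 := by simpa using hs
  set a := -(y + m * s) with ha
  have hsplit : (fun w => bcG m (y + m * s + w)) = fun w =>
      (Set.Ioi a).indicator (fun _ => (1:ℝ)) w -
      (Set.Iic a).indicator (fun w => Real.exp (-2 * m * y) * Real.exp (-2 * m * (m * s + w))) w := by
    funext w
    unfold bcG
    by_cases h : 0 < y + m * s + w
    · have h1 : w ∈ Set.Ioi a := by simp only [Set.mem_Ioi, ha]; linarith
      have h2 : w ∉ Set.Iic a := by simpa using h1
      rw [if_pos h, Set.indicator_of_mem h1, Set.indicator_of_notMem h2, sub_zero]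
    · have h2 : w ∈ Set.Iic a := by simp only [Set.mem_Iic, ha]; linarith
      have h1 : w ∉ Set.Ioi a := by simpa using h2
      rw [if_neg h, Set.indicator_of_notMem h1, Set.indicator_of_mem h2, zero_sub, ← Real.exp_add]
      congr 2
      ring
  have hi : Integrable (fun w => Real.exp (-2 * m * y) * Real.exp (-2 * m * (m * s + w)))
      (gaussianReal 0 (Real.toNNReal s)) := by
    have := (integrable_exp_mul_gaussianReal (μ := 0) (v := Real.toNNReal s) (-2 * m)).const_mul
      (Real.exp (-2 * m * y) * Real.exp (-2 * m * (m * s)))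
    convert this using 2
    rw [mul_add (-2 * m), Real.exp_add]
    ring
  rw [hsplit, integral_sub ((integrable_const _).indicator measurableSet_Ioi)
    (hi.indicator measurableSet_Iic)]
  unfold bcU
  congr 1
  · rw [integral_indicator measurableSet_Ioi]
    simp only [integral_const, smul_eq_mul, mul_one, MeasurableSet.univ, measureReal_restrict_apply,
      Set.univ_inter]
    have := bc_cdf_Ioi s a hs
    rw [Measure.real, this, ha, neg_neg]
  · have : (-y + m * s) = a - (-2 * m * s) := by rw [ha]; ring
    rw [this, ← bc_cdf_eq (-2 * m * s) s a hs, gaussianReal_apply_eq_integral _ hv,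
      ENNReal.toReal_ofReal (integral_nonneg (gaussianPDFReal_nonneg _ _)),
      ← integral_const_mul, integral_gaussianReal_eq_integral_smul hv,
      ← integral_indicator measurableSet_Iic]
    congr 1
    funext w
    by_cases h2 : w ∈ Set.Iic a
    · rw [Set.indicator_of_mem h2, Set.indicator_of_mem h2, ← bc_tilt m s hs, smul_eq_mul]
      ring
    · rw [Set.indicator_of_notMem h2, Set.indicator_of_notMem h2, smul_zero]

lemma bcU_bound (m s y ε T : ℝ) (hs : 0 < s) (hsT : s ≤ T) (hy : |y| ≤ ε * √s) :
    |bcU m s y| ≤ (Real.exp (2 * |m| * (ε * √T)) - 1) + 2 * ε := by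
  have hss : 0 < √s := Real.sqrt_pos.2 hs
  have hε : 0 ≤ ε := by
    by_contra hneg
    push Not at hneg
    have := abs_nonneg y
    nlinarith
  have h1 : |stdNormalCDF ((y + m * s) / √s) - stdNormalCDF ((-y + m * s) / √s)| ≤ 2 * ε := by
    refine (bc_cdf_lip _ _).trans ?_
    have : (y + m * s) / √s - (-y + m * s) / √s = 2 * y / √s := by ring
    rw [this, abs_div, abs_of_pos hss, div_le_iff₀ hss, abs_mul, abs_two]
    linarith
  have h2 : |1 - Real.exp (-2 * m * y)| ≤ Real.exp (2 * |m| * (ε * √T)) - 1 := by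
    have hz : |(-2 * m * y)| ≤ 2 * |m| * (ε * √T) := by
      rw [abs_mul, abs_mul, abs_neg, abs_two]
      have := Real.sqrt_le_sqrt hsT
      gcongr
      exact hy.trans (by gcongr)
    have hz' := abs_le.1 hz
    have e1 : Real.exp (-2 * m * y) ≤ Real.exp (2 * |m| * (ε * √T)) := Real.exp_le_exp.2 hz'.2
    have e2 : Real.exp (-(2 * |m| * (ε * √T))) ≤ Real.exp (-2 * m * y) := Real.exp_le_exp.2 hz'.1
    have e3 := Real.add_one_le_exp (2 * |m| * (ε * √T))
    have e4 := Real.add_one_le_exp (-(2 * |m| * (ε * √T)))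
    rw [abs_le]
    constructor <;> linarith
  have h3 : bcU m s y = (stdNormalCDF ((y + m * s) / √s) - stdNormalCDF ((-y + m * s) / √s)) +
      (1 - Real.exp (-2 * m * y)) * stdNormalCDF ((-y + m * s) / √s) := by
    unfold bcU; ring
  rw [h3]
  refine (abs_add_le _ _).trans ?_
  rw [abs_mul, abs_of_nonneg (bc_cdf_nonneg _)]
  have := mul_le_mul_of_nonneg_left (bc_cdf_le_one ((-y + m * s) / √s)) (abs_nonneg (1 - Real.exp (-2 * m * y)))
  linarith

lemma bc_step {Ω : Type*} [MeasurableSpace Ω] (P : Measure Ω) [IsProbabilityMeasure P]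
    (B : ℝ → Ω → ℝ)
    (hBmeas : ∀ t, Measurable (B t))
    (hBincr : ∀ u v : ℝ, 0 ≤ u → u ≤ v →
      Measure.map (fun ω => B v ω - B u ω) P = gaussianReal 0 (Real.toNNReal (v - u)))
    (hBindep : ∀ u v : ℝ, 0 ≤ u → u ≤ v →
      Indep (MeasurableSpace.comap (fun ω => B v ω - B u ω) (borel ℝ))
        (⨆ w ∈ Set.Icc (0:ℝ) u, MeasurableSpace.comap (B w) (borel ℝ)) P)
    (x m t T η : ℝ) (ht : 0 ≤ t) (htT : t < T)
    (hint : Integrable (fun ω => bcG m (x + m * T + B T ω)) P)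
    (C : Set Ω)
    (hC : MeasurableSet[⨆ w ∈ Set.Icc (0:ℝ) t, MeasurableSpace.comap (B w) (borel ℝ)] C)
    (hU : ∀ ω ∈ C, |bcU m (T - t) (x + m * t + B t ω)| ≤ η) :
    |∫ ω in C, bcG m (x + m * T + B T ω) ∂P| ≤ η * P.real C := by
  classical
  have hle : (⨆ w ∈ Set.Icc (0:ℝ) t, MeasurableSpace.comap (B w) (borel ℝ)) ≤ ‹MeasurableSpace Ω› := by
    refine iSup₂_le fun w _ => ?_
    have := (hBmeas w).comap_le
    rwa [BorelSpace.measurable_eq (α := ℝ)] at this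
  have hC' : MeasurableSet C := hle _ hC
  set f : Ω → ℝ × ℝ := fun ω => (C.indicator (fun _ => (1:ℝ)) ω, B t ω) with hf
  set W : Ω → ℝ := fun ω => B T ω - B t ω with hW
  have hWm : Measurable W := (hBmeas T).sub (hBmeas t)
  have hfm : Measurable f := (measurable_const.indicator hC').prodMk (hBmeas t)
  have hfF : Measurable[⨆ w ∈ Set.Icc (0:ℝ) t, MeasurableSpace.comap (B w) (borel ℝ)] f := by
    refine Measurable.prodMk (measurable_const.indicator hC) ?_
    rw [measurable_iff_comap_le, BorelSpace.measurable_eq (α := ℝ)]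
    exact le_iSup₂ (f := fun w (_ : w ∈ Set.Icc (0:ℝ) t) => MeasurableSpace.comap (B w) (borel ℝ)) t ⟨ht, le_rfl⟩
  have hind : IndepFun f W P := by
    rw [IndepFun_iff_Indep]
    have h := (hBindep t T ht htT.le).symm
    rw [← BorelSpace.measurable_eq (α := ℝ)] at h
    rw [← BorelSpace.measurable_eq (α := ℝ)] at hfF
    exact indep_of_indep_of_le_left h hfF.comap_le
  have hmap := (indepFun_iff_map_prod_eq_prod_map_map hfm.aemeasurable hWm.aemeasurable).1 hind
  rw [hBincr t T ht htT.le] at hmap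
  set h : (ℝ × ℝ) × ℝ → ℝ := fun p => p.1.1 * bcG m (x + m * T + p.1.2 + p.2) with hh
  have hhm : Measurable h := by
    have := bcG_meas m
    exact (measurable_fst.comp measurable_fst).mul (this.comp (by fun_prop))
  have hcomp : ∀ ω, h (f ω, W ω) = C.indicator (fun ω => bcG m (x + m * T + B T ω)) ω := by
    intro ω
    have e : x + m * T + B t ω + (B T ω - B t ω) = x + m * T + B T ω := by ring
    simp only [hh, hf, hW, e]
    by_cases hω : ω ∈ C <;> simp [hω]
  have hpm : Measurable (fun ω => (f ω, W ω)) := hfm.prodMk hWm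
  have hmapint : Integrable h (P.map (fun ω => (f ω, W ω))) := by
    rw [integrable_map_measure hhm.aestronglyMeasurable hpm.aemeasurable]
    refine (hint.indicator hC').congr (ae_of_all _ fun ω => (hcomp ω).symm)
  have hbU : Measurable (bcU m (T - t)) := by
    have := bc_cdf_continuous
    unfold bcU
    apply Continuous.measurable
    fun_prop
  have key : ∫ ω in C, bcG m (x + m * T + B T ω) ∂P =
      ∫ ω in C, bcU m (T - t) (x + m * t + B t ω) ∂P := by
    rw [← integral_indicator hC', ← integral_indicator hC']
    calc ∫ ω, C.indicator (fun ω => bcG m (x + m * T + B T ω)) ω ∂P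
        = ∫ ω, h (f ω, W ω) ∂P := by simp_rw [hcomp]
      _ = ∫ p, h p ∂(P.map (fun ω => (f ω, W ω))) :=
          (integral_map hpm.aemeasurable hhm.aestronglyMeasurable).symm
      _ = ∫ q, ∫ w, h (q, w) ∂(gaussianReal 0 (Real.toNNReal (T - t))) ∂(P.map f) := by
          rw [hmap] at hmapint ⊢
          exact integral_prod _ hmapint
      _ = ∫ q, q.1 * bcU m (T - t) (x + m * t + q.2) ∂(P.map f) := by
          congr 1
          funext q
          simp only [hh]
          rw [integral_const_mul, ← bc_gauss m (T - t) _ (by linarith)]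
          congr 2
          funext w
          congr 1
          ring
      _ = ∫ ω, C.indicator (fun ω => bcU m (T - t) (x + m * t + B t ω)) ω ∂P := by
          rw [integral_map hfm.aemeasurable]
          · congr 1
            funext ω
            by_cases hω : ω ∈ C <;> simp [hf, hω]
          · exact (measurable_fst.mul (hbU.comp (by fun_prop))).aestronglyMeasurable
  rw [key, ← Real.norm_eq_abs]
  exact norm_setIntegral_le_of_norm_le_const (measure_lt_top P C) (fun ω hω => hU ω hω)

lemma bc_det1 (f : ℝ → ℝ) (T ε : ℝ) (hT : 0 < T) (hε : 0 < ε) (hf : ContinuousOn f (Set.Ici 0))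
    (hf0 : 0 < f 0) (hA : ∃ n : ℕ, ∃ k : ℕ, k < 2 ^ n ∧ f (k * T / 2 ^ n) ≤ 0) :
    ∃ N : ℕ, ∀ n ≥ N, ∃ k : ℕ, k < 2 ^ n ∧ f (k * T / 2 ^ n) ≤ 0 ∧
      (∀ j < k, 0 < f (j * T / 2 ^ n)) ∧ -(ε * √(T - k * T / 2 ^ n)) ≤ f (k * T / 2 ^ n) := by
  classical
  obtain ⟨n0, k0, hk0, hfk0⟩ := hA
  set t0 : ℝ := k0 * T / 2 ^ n0 with ht0
  have ht0T : t0 < T := by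
    rw [ht0, div_lt_iff₀ (by positivity), mul_comm]
    have : (k0 : ℝ) < 2 ^ n0 := by exact_mod_cast hk0
    gcongr
  have he : 0 < ε * √(T - t0) := mul_pos hε (Real.sqrt_pos.2 (by linarith))
  have huc : UniformContinuousOn f (Set.Icc 0 T) :=
    isCompact_Icc.uniformContinuousOn_of_continuous (hf.mono Set.Icc_subset_Ici_self)
  rw [Metric.uniformContinuousOn_iff] at huc
  obtain ⟨δ, hδ, huc⟩ := huc _ he
  obtain ⟨N1, hN1⟩ := exists_pow_lt_of_lt_one (div_pos hδ hT) (by norm_num : (1/2 : ℝ) < 1)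
  refine ⟨max n0 N1, fun n hn => ?_⟩
  have hn0 : n0 ≤ n := (le_max_left _ _).trans hn
  have hn1 : N1 ≤ n := (le_max_right _ _).trans hn
  have hpow : (0:ℝ) < 2 ^ n := by positivity
  have hmesh : T / 2 ^ n < δ := by
    have h1 : (1/2 : ℝ) ^ n ≤ (1/2) ^ N1 := pow_le_pow_of_le_one (by norm_num) (by norm_num) hn1
    have h2 := h1.trans_lt hN1
    rw [lt_div_iff₀ hT] at h2
    calc T / 2 ^ n = (1/2 : ℝ) ^ n * T := by rw [one_div, inv_pow]; field_simp
      _ < δ := h2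
  have hsplit : (2:ℝ) ^ n = 2 ^ n0 * 2 ^ (n - n0) := by rw [← pow_add]; congr 1; omega
  have ht0' : ((k0 * 2 ^ (n - n0) : ℕ) : ℝ) * T / 2 ^ n = t0 := by
    rw [ht0, hsplit]; push_cast; field_simp
  have hex : ∃ k : ℕ, f (k * T / 2 ^ n) ≤ 0 := ⟨k0 * 2 ^ (n - n0), by rw [ht0']; exact hfk0⟩
  have hkle : Nat.find hex ≤ k0 * 2 ^ (n - n0) := Nat.find_min' hex (by rw [ht0']; exact hfk0)
  have hkspec := Nat.find_spec hex
  have hkmin : ∀ j < Nat.find hex, 0 < f (j * T / 2 ^ n) := fun j hj => not_le.1 (Nat.find_min hex hj)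
  generalize Nat.find hex = k at hkle hkspec hkmin
  have htk : (k : ℝ) * T / 2 ^ n ≤ t0 := by
    rw [← ht0']
    have : (k : ℝ) ≤ ((k0 * 2 ^ (n - n0) : ℕ) : ℝ) := by exact_mod_cast hkle
    gcongr
  refine ⟨k, ?_, hkspec, hkmin, ?_⟩
  · have h1 : (k : ℝ) * T / 2 ^ n < T := htk.trans_lt ht0T
    rw [div_lt_iff₀ hpow, mul_comm, mul_lt_mul_iff_right₀ hT] at h1
    exact_mod_cast h1
  · have hkne : k ≠ 0 := by
      rintro rfl
      simp at hkspec
      linarith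
    obtain ⟨j, rfl⟩ := Nat.exists_eq_succ_of_ne_zero hkne
    have hj := hkmin j (Nat.lt_succ_self j)
    have hjk : ((j.succ : ℕ) : ℝ) * T / 2 ^ n - j * T / 2 ^ n = T / 2 ^ n := by
      push_cast; ring
    have hTp : 0 < T / 2 ^ n := by positivity
    have hd := huc (((j.succ : ℕ) : ℝ) * T / 2 ^ n) ⟨by positivity, by linarith⟩ (j * T / 2 ^ n)
      ⟨by positivity, by linarith⟩ (by rw [Real.dist_eq, hjk, abs_of_pos hTp]; exact hmesh)
    rw [Real.dist_eq] at hd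
    have h3 : ε * √(T - t0) ≤ ε * √(T - ((j.succ : ℕ) : ℝ) * T / 2 ^ n) := by gcongr
    have := (abs_lt.1 hd).1
    linarith

lemma bc_det2 (f : ℝ → ℝ) (T : ℝ) (hT : 0 < T) (hf : ContinuousOn f (Set.Ici 0))
    (hA : ∀ n : ℕ, ∀ k : ℕ, k < 2 ^ n → 0 < f (k * T / 2 ^ n)) (t : ℝ) (ht : t ∈ Set.Icc 0 T) :
    0 ≤ f t := by
  by_contra hneg
  push Not at hneg
  have hc := hf t ht.1
  rw [Metric.continuousWithinAt_iff] at hc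
  obtain ⟨δ, hδ, hc⟩ := hc (-f t) (by linarith)
  obtain ⟨n, hn⟩ := exists_pow_lt_of_lt_one (div_pos hδ hT) (by norm_num : (1/2 : ℝ) < 1)
  have hpow : (0:ℝ) < 2 ^ n := by positivity
  have hmesh : T / 2 ^ n < δ := by
    rw [lt_div_iff₀ hT] at hn
    calc T / 2 ^ n = (1/2 : ℝ) ^ n * T := by rw [one_div, inv_pow]; field_simp
      _ < δ := hn
  have hk : ∃ k : ℕ, k < 2 ^ n ∧ |(k : ℝ) * T / 2 ^ n - t| ≤ T / 2 ^ n := by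
    have hval : ∀ k : ℕ, (k : ℝ) * T / 2 ^ n - t = ((k : ℝ) - t * 2 ^ n / T) * (T / 2 ^ n) := by
      intro k; field_simp
    have hfin : ∀ k : ℕ, |(k : ℝ) - t * 2 ^ n / T| ≤ 1 → |(k : ℝ) * T / 2 ^ n - t| ≤ T / 2 ^ n := by
      intro k hk
      rw [hval, abs_mul, abs_of_pos (show 0 < T / 2 ^ n by positivity)]
      have : 0 < T / 2 ^ n := by positivity
      nlinarith
    rcases lt_or_eq_of_le ht.2 with h | h
    · refine ⟨⌊t * 2 ^ n / T⌋₊, ?_, hfin _ ?_⟩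
      · have h0 : 0 ≤ t * 2 ^ n / T := by have := ht.1; positivity
        rw [Nat.floor_lt h0]
        push_cast
        rw [div_lt_iff₀ hT]
        nlinarith
      · have h0 : 0 ≤ t * 2 ^ n / T := by have := ht.1; positivity
        have h1 := Nat.floor_le h0
        have h2 := Nat.lt_floor_add_one (t * 2 ^ n / T)
        rw [abs_le]; constructor <;> linarith
    · have h1 : 1 ≤ 2 ^ n := Nat.one_le_two_pow
      refine ⟨2 ^ n - 1, by omega, hfin _ ?_⟩
      rw [h, Nat.cast_sub h1]
      push_cast
      rw [mul_div_assoc, mul_comm, div_mul_cancel₀ _ hT.ne']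
      simp
  obtain ⟨k, hk, hkt⟩ := hk
  have h1 := hA n k hk
  have h2 := hc (x := k * T / 2 ^ n) (by simp only [Set.mem_Ici]; positivity)
    (by rw [Real.dist_eq]; linarith)
  rw [Real.dist_eq] at h2
  have := (abs_lt.1 h2).2
  linarith

lemma bc_main {Ω : Type*} [MeasurableSpace Ω] (P : Measure Ω) [IsProbabilityMeasure P]
    (B : ℝ → Ω → ℝ)
    (hBmeas : ∀ t, Measurable (B t))
    (hB0 : ∀ᵐ ω ∂P, B 0 ω = 0)
    (hBcont : ∀ᵐ ω ∂P, ContinuousOn (fun t => B t ω) (Set.Ici 0))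
    (hBincr : ∀ u v : ℝ, 0 ≤ u → u ≤ v →
      Measure.map (fun ω => B v ω - B u ω) P = gaussianReal 0 (Real.toNNReal (v - u)))
    (hBindep : ∀ u v : ℝ, 0 ≤ u → u ≤ v →
      Indep (MeasurableSpace.comap (fun ω => B v ω - B u ω) (borel ℝ))
        (⨆ w ∈ Set.Icc (0:ℝ) u, MeasurableSpace.comap (B w) (borel ℝ)) P)
    (x m T : ℝ) (hx : 0 < x) (hT : 0 < T) :
    P.real {ω | ∀ n : ℕ, ∀ k : ℕ, k < 2 ^ n →
      0 < x + m * (k * T / 2 ^ n) + B (k * T / 2 ^ n) ω} = bcU m T x := by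
  classical
  set X : ℝ → Ω → ℝ := fun t ω => x + m * t + B t ω with hX
  have hXm : ∀ t, Measurable (X t) := fun t => measurable_const.add (hBmeas t)
  -- law of `B T`
  have hlaw : P.map (B T) = gaussianReal 0 (Real.toNNReal T) := by
    rw [← sub_zero T, ← hBincr 0 T le_rfl hT.le, sub_zero]
    refine Measure.map_congr ?_
    filter_upwards [hB0] with ω hω
    rw [hω, sub_zero]
  have hGm : Measurable (fun w => bcG m (x + m * T + w)) := (bcG_meas m).comp (by fun_prop)
  set Z : Ω → ℝ := fun ω => bcG m (x + m * T + B T ω) with hZ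
  have hint : Integrable Z P := by
    have := bcG_integrable m (x + m * T) (Real.toNNReal T)
    rw [← hlaw, integrable_map_measure hGm.aestronglyMeasurable (hBmeas T).aemeasurable] at this
    exact this
  have htot : ∫ ω, Z ω ∂P = bcU m T x := by
    rw [← bc_gauss m T x hT, ← hlaw, integral_map (hBmeas T).aemeasurable hGm.aestronglyMeasurable]
  have hne : ∀ᵐ ω ∂P, X T ω ≠ 0 := by
    have hv : Real.toNNReal T ≠ 0 := by simpa using hT
    have := nullSingletonClass_gaussianReal (μ := 0) hv
    have h0 : ∀ᵐ w ∂(P.map (B T)), w ≠ -(x + m * T) := by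
      rw [hlaw, ae_iff]
      simp
    have h1 := ae_of_ae_map (hBmeas T).aemeasurable h0
    filter_upwards [h1] with ω hω h
    exact hω (by simp only [hX] at h; linarith)
  set A : Set Ω := {ω | ∃ n : ℕ, ∃ k : ℕ, k < 2 ^ n ∧ X (k * T / 2 ^ n) ω ≤ 0} with hAdef
  have hAm : MeasurableSet A := by
    have : A = ⋃ n : ℕ, ⋃ k : ℕ, ⋃ _ : k < 2 ^ n, {ω | X (k * T / 2 ^ n) ω ≤ 0} := by
      ext ω; simp [hAdef]
    rw [this]
    exact MeasurableSet.iUnion fun n => MeasurableSet.iUnion fun k => MeasurableSet.iUnion fun _ =>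
      measurableSet_le (hXm _) measurable_const
  have hAc : {ω | ∀ n : ℕ, ∀ k : ℕ, k < 2 ^ n →
      0 < x + m * (k * T / 2 ^ n) + B (k * T / 2 ^ n) ω} = Aᶜ := by
    ext ω
    simp [hAdef, hX]
  have hXc : ∀ᵐ ω ∂P, ContinuousOn (fun t => X t ω) (Set.Ici 0) := by
    filter_upwards [hBcont] with ω hω
    exact ContinuousOn.add (by fun_prop) hω
  -- the integral over `A` vanishes
  have hη : ∀ ε : ℝ, 0 < ε → |∫ ω in A, Z ω ∂P| ≤ (Real.exp (2 * |m| * (ε * √T)) - 1) + 2 * ε := by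
    intro ε hε
    set η := (Real.exp (2 * |m| * (ε * √T)) - 1) + 2 * ε with hηdef
    have hη0 : 0 ≤ η := by
      have : 0 ≤ 2 * |m| * (ε * √T) := by positivity
      have := Real.add_one_le_exp (2 * |m| * (ε * √T))
      linarith
    set C : ℕ → ℕ → Set Ω := fun n k => {ω | X (k * T / 2 ^ n) ω ≤ 0 ∧
      (∀ j < k, 0 < X (j * T / 2 ^ n) ω) ∧
      -(ε * √(T - k * T / 2 ^ n)) ≤ X (k * T / 2 ^ n) ω} with hCdef
    have hCmF : ∀ n k : ℕ, MeasurableSet[⨆ w ∈ Set.Icc (0:ℝ) (k * T / 2 ^ n),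
        MeasurableSpace.comap (B w) (borel ℝ)] (C n k) := by
      intro n k
      have hBw : ∀ w ∈ Set.Icc (0:ℝ) (k * T / 2 ^ n),
          Measurable[⨆ w ∈ Set.Icc (0:ℝ) (k * T / 2 ^ n),
        MeasurableSpace.comap (B w) (borel ℝ)] (X w) := by
        intro w hw
        refine Measurable.add measurable_const ?_
        rw [measurable_iff_comap_le, BorelSpace.measurable_eq (α := ℝ)]
        exact le_iSup₂ (f := fun w (_ : w ∈ Set.Icc (0:ℝ) (k * T / 2 ^ n)) =>
          MeasurableSpace.comap (B w) (borel ℝ)) w hw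
      have hk := hBw (k * T / 2 ^ n) ⟨by positivity, le_rfl⟩
      have : C n k = {ω | X (k * T / 2 ^ n) ω ≤ 0} ∩
          ((⋂ j : ℕ, ⋂ _ : j < k, {ω | 0 < X (j * T / 2 ^ n) ω}) ∩
          {ω | -(ε * √(T - k * T / 2 ^ n)) ≤ X (k * T / 2 ^ n) ω}) := by
        ext ω; simp [hCdef]
      rw [this]
      refine MeasurableSet.inter (measurableSet_le hk measurable_const)
        (MeasurableSet.inter ?_ (measurableSet_le measurable_const hk))
      refine MeasurableSet.iInter fun j => MeasurableSet.iInter fun hj => ?_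
      refine measurableSet_lt measurable_const (hBw _ ⟨by positivity, ?_⟩)
      have : (j : ℝ) ≤ k := by exact_mod_cast hj.le
      gcongr
    have hCm : ∀ n k, MeasurableSet (C n k) := by
      intro n k
      have hle : (⨆ w ∈ Set.Icc (0:ℝ) (k * T / 2 ^ n), MeasurableSpace.comap (B w) (borel ℝ)) ≤
          ‹MeasurableSpace Ω› := by
        refine iSup₂_le fun w _ => ?_
        have := (hBmeas w).comap_le
        rwa [BorelSpace.measurable_eq (α := ℝ)] at this
      exact hle _ (hCmF n k)
    set R : ℕ → Set Ω := fun n => ⋃ k ∈ Finset.range (2 ^ n), C n k with hRdef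
    have hRm : ∀ n, MeasurableSet (R n) := fun n =>
      Finset.measurableSet_biUnion _ fun k _ => hCm n k
    have hdisj : ∀ n, Set.PairwiseDisjoint (↑(Finset.range (2 ^ n))) (C n) := by
      intro n i _ j _ hij
      rw [Function.onFun, Set.disjoint_left]
      intro ω hi hj
      rcases lt_or_gt_of_ne hij with h | h
      · exact absurd hi.1 (not_le.2 (hj.2.1 i h))
      · exact absurd hj.1 (not_le.2 (hi.2.1 j h))
    have hRbound : ∀ n, |∫ ω in R n, Z ω ∂P| ≤ η := by
      intro n
      rw [hRdef]
      simp only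
      rw [integral_biUnion_finset _ (fun k _ => hCm n k) (hdisj n) (fun k _ => hint.integrableOn)]
      calc |∑ k ∈ Finset.range (2 ^ n), ∫ ω in C n k, Z ω ∂P|
          ≤ ∑ k ∈ Finset.range (2 ^ n), |∫ ω in C n k, Z ω ∂P| := Finset.abs_sum_le_sum_abs _ _
        _ ≤ ∑ k ∈ Finset.range (2 ^ n), η * P.real (C n k) := by
            refine Finset.sum_le_sum fun k hk => ?_
            have hkn : (k : ℝ) < 2 ^ n := by exact_mod_cast Finset.mem_range.1 hk
            have htT : (k : ℝ) * T / 2 ^ n < T := by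
              rw [div_lt_iff₀ (by positivity), mul_comm]
              gcongr
            have ht0 : 0 ≤ (k : ℝ) * T / 2 ^ n := by positivity
            refine bc_step P B hBmeas hBincr hBindep x m _ T η ht0 htT hint _ (hCmF n k) ?_
            intro ω hω
            refine bcU_bound m _ _ ε T (by linarith) (by linarith) ?_
            have h1 : x + m * (k * T / 2 ^ n) + B (k * T / 2 ^ n) ω ≤ 0 := hω.1
            rw [abs_of_nonpos h1]
            have h2 : -(ε * √(T - k * T / 2 ^ n)) ≤
              x + m * (k * T / 2 ^ n) + B (k * T / 2 ^ n) ω := hω.2.2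
            linarith
        _ = η * P.real (R n) := by
            rw [← Finset.mul_sum, measureReal_biUnion_finset (hdisj n) (fun k _ => hCm n k)]
        _ ≤ η := by
            have := measureReal_le_one (μ := P) (s := R n)
            nlinarith
    have hlim : Filter.Tendsto (fun n => ∫ ω in R n, Z ω ∂P) Filter.atTop
        (nhds (∫ ω in A, Z ω ∂P)) := by
      simp_rw [← integral_indicator (hRm _)]
      rw [← integral_indicator hAm]
      refine tendsto_integral_of_dominated_convergence (fun ω => ‖Z ω‖)
        (fun n => (hint.indicator (hRm n)).aestronglyMeasurable) hint.norm
        (fun n => ae_of_all _ fun ω => norm_indicator_le_norm_self _ _) ?_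
      filter_upwards [hXc, hB0] with ω hω h0
      by_cases hωA : ω ∈ A
      · obtain ⟨N, hN⟩ := bc_det1 (fun t => X t ω) T ε hT hε hω (by simp [hX, h0, hx]) hωA
        refine tendsto_const_nhds.congr' ?_
        filter_upwards [Filter.eventually_ge_atTop N] with n hn
        obtain ⟨k, hk, hk2⟩ := hN n hn
        have : ω ∈ R n := by
          simp only [hRdef, Set.mem_iUnion, Finset.mem_range]
          exact ⟨k, hk, hk2⟩
        rw [Set.indicator_of_mem hωA, Set.indicator_of_mem this]
      · refine tendsto_const_nhds.congr fun n => ?_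
        have : ω ∉ R n := by
          intro h
          simp only [hRdef, Set.mem_iUnion, Finset.mem_range] at h
          obtain ⟨k, hk, hk2⟩ := h
          exact hωA ⟨n, k, hk, hk2.1⟩
        rw [Set.indicator_of_notMem hωA, Set.indicator_of_notMem this]
    exact le_of_tendsto hlim.abs (Filter.Eventually.of_forall hRbound)
  have hA0 : ∫ ω in A, Z ω ∂P = 0 := by
    have hc : Filter.Tendsto (fun ε : ℝ => (Real.exp (2 * |m| * (ε * √T)) - 1) + 2 * ε)
        (nhdsWithin 0 (Set.Ioi 0)) (nhds 0) := by
      have : Continuous (fun ε : ℝ => (Real.exp (2 * |m| * (ε * √T)) - 1) + 2 * ε) := by fun_prop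
      have h := this.tendsto 0
      simp only [zero_mul, mul_zero, Real.exp_zero, sub_self, add_zero] at h
      exact h.mono_left nhdsWithin_le_nhds
    have := ge_of_tendsto hc (Filter.eventually_of_mem self_mem_nhdsWithin fun ε hε => hη ε hε)
    exact abs_eq_zero.1 (le_antisymm this (abs_nonneg _))
  have hsum := integral_add_compl hAm hint
  rw [hA0, zero_add, htot] at hsum
  rw [hAc, ← hsum]
  have : ∫ ω in Aᶜ, Z ω ∂P = ∫ ω in Aᶜ, (1:ℝ) ∂P := by
    refine setIntegral_congr_ae hAm.compl ?_
    filter_upwards [hXc, hne] with ω hω hn hωA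
    have h1 := bc_det2 (fun t => X t ω) T hT hω (fun n k hk => by
      by_contra h
      exact hωA ⟨n, k, hk, not_lt.1 h⟩) T ⟨hT.le, le_rfl⟩
    have h2 : 0 < x + m * T + B T ω := lt_of_le_of_ne h1 (Ne.symm hn)
    simp only [hZ, bcG, if_pos h2]
  rw [this]
  simp

lemma bc_drift {Ω : Type*} [MeasurableSpace Ω] (P : Measure Ω) [IsProbabilityMeasure P]
    (B : ℝ → Ω → ℝ)
    (hBmeas : ∀ t, Measurable (B t))
    (hB0 : ∀ᵐ ω ∂P, B 0 ω = 0)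
    (hBcont : ∀ᵐ ω ∂P, ContinuousOn (fun t => B t ω) (Set.Ici 0))
    (hBincr : ∀ u v : ℝ, 0 ≤ u → u ≤ v →
      Measure.map (fun ω => B v ω - B u ω) P = gaussianReal 0 (Real.toNNReal (v - u)))
    (hBindep : ∀ u v : ℝ, 0 ≤ u → u ≤ v →
      Indep (MeasurableSpace.comap (fun ω => B v ω - B u ω) (borel ℝ))
        (⨆ w ∈ Set.Icc (0:ℝ) u, MeasurableSpace.comap (B w) (borel ℝ)) P)
    (x m T : ℝ) (hx : 0 < x) (hT : 0 < T) :
    P.real {ω | ∀ t ∈ Set.Icc (0:ℝ) T, 0 < x + m * t + B t ω} = bcU m T x := by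
  have hmain := fun y hy => bc_main P B hBmeas hB0 hBcont hBincr hBindep y m T hy hT
  apply le_antisymm
  · rw [← hmain x hx]
    refine measureReal_mono ?_
    intro ω hω n k hk
    refine hω _ ⟨by positivity, ?_⟩
    have : (k : ℝ) ≤ 2 ^ n := by exact_mod_cast hk.le
    rw [div_le_iff₀ (by positivity), mul_comm]
    gcongr
  · have hc : Filter.Tendsto (fun y => bcU m T y) (nhdsWithin x (Set.Iio x)) (nhds (bcU m T x)) := by
      have : Continuous (fun y => bcU m T y) := by
        have := bc_cdf_continuous
        unfold bcU
        fun_prop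
      exact (this.tendsto x).mono_left nhdsWithin_le_nhds
    refine le_of_tendsto hc ?_
    filter_upwards [Ioo_mem_nhdsLT hx] with y hy
    rw [← hmain y hy.1]
    refine ENNReal.toReal_mono (measure_ne_top _ _) (measure_mono_ae ?_)
    filter_upwards [hBcont] with ω hω hA t ht
    have h1 := bc_det2 (fun t => y + m * t + B t ω) T hT
      (ContinuousOn.add (by fun_prop) hω) hA t ht
    have h2 := hy.2
    linarith

theorem black_cox_survival_probability
    {Ω : Type*} [MeasurableSpace Ω] (P : Measure Ω) [IsProbabilityMeasure P]
    (B : ℝ → Ω → ℝ)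
    (hBmeas : ∀ t, Measurable (B t))
    (hB0 : ∀ᵐ ω ∂P, B 0 ω = 0)
    (hBcont : ∀ᵐ ω ∂P, ContinuousOn (fun t => B t ω) (Set.Ici 0))
    (hBincr : ∀ u v : ℝ, 0 ≤ u → u ≤ v →
      Measure.map (fun ω => B v ω - B u ω) P = gaussianReal 0 (Real.toNNReal (v - u)))
    (hBindep : ∀ u v : ℝ, 0 ≤ u → u ≤ v →
      Indep (MeasurableSpace.comap (fun ω => B v ω - B u ω) (borel ℝ))
        (⨆ w ∈ Set.Icc (0:ℝ) u, MeasurableSpace.comap (B w) (borel ℝ)) P)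
    (V₀ H σ μ T : ℝ) (hH : 0 < H) (hV₀ : H < V₀) (hσ : 0 < σ) (hT : 0 < T) :
    (P {ω | ∀ t ∈ Set.Icc (0:ℝ) T,
        H < V₀ * Real.exp ((μ - σ ^ 2 / 2) * t + σ * B t ω)}).toReal
      = stdNormalCDF ((Real.log (V₀ / H) + (μ - σ ^ 2 / 2) * T) / (σ * Real.sqrt T))
        - (V₀ / H) ^ (1 - 2 * μ / σ ^ 2) *
          stdNormalCDF ((-Real.log (V₀ / H) + (μ - σ ^ 2 / 2) * T) / (σ * Real.sqrt T)) := by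
  have hVpos : 0 < V₀ := hH.trans hV₀
  have hq : 0 < V₀ / H := div_pos hVpos hH
  set L := Real.log (V₀ / H) with hL
  have hLpos : 0 < L := Real.log_pos ((one_lt_div hH).2 hV₀)
  have hd := bc_drift P B hBmeas hB0 hBcont hBincr hBindep (L / σ) ((μ - σ ^ 2 / 2) / σ) T
    (div_pos hLpos hσ) hT
  have hset : {ω | ∀ t ∈ Set.Icc (0:ℝ) T,
        H < V₀ * Real.exp ((μ - σ ^ 2 / 2) * t + σ * B t ω)} =
      {ω | ∀ t ∈ Set.Icc (0:ℝ) T, 0 < L / σ + (μ - σ ^ 2 / 2) / σ * t + B t ω} := by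
    ext ω
    simp only [Set.mem_ofPred_eq]
    refine forall₂_congr fun t _ => ?_
    have e1 : V₀ = H * Real.exp L := by
      rw [hL, Real.exp_log hq]; field_simp
    have e2 : V₀ * Real.exp ((μ - σ ^ 2 / 2) * t + σ * B t ω) =
        H * Real.exp (L + ((μ - σ ^ 2 / 2) * t + σ * B t ω)) := by
      rw [Real.exp_add L, ← mul_assoc, ← e1]
    have e3 : L / σ + (μ - σ ^ 2 / 2) / σ * t + B t ω =
        (L + ((μ - σ ^ 2 / 2) * t + σ * B t ω)) / σ := by
      field_simp; ring
    rw [e2, e3, lt_mul_iff_one_lt_right hH, Real.one_lt_exp_iff, div_pos_iff_of_pos_right hσ]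
  rw [hset]
  refine hd.trans ?_
  unfold bcU
  have hs : 0 < √T := Real.sqrt_pos.2 hT
  congr 1
  · congr 1
    field_simp
  · congr 1
    · rw [Real.rpow_def_of_pos hq, ← hL]
      congr 1
      field_simp
      ring
    · congr 1
      field_simp
end

section
/- Fix a > 0 and β ∈ ℝ. Then the map s ↦ Φ((a + β·s)/√s) − exp(−2·β·a)·Φ((−a + β·s)/√s) is strictly decreasing on (0, ∞). (In the AT1P model, where s = ∫₀^T σ_u² du is nondecreasing in the horizon T, this expresses that the survival probability T ↦ Q(τ > T) is decreasing in maturity.) -/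
open MeasureTheory ProbabilityTheory

lemma stdNormalCDF_eq (x : ℝ) :
    stdNormalCDF x = ∫ u in Set.Iic x, gaussianPDFReal 0 1 u := by
  unfold stdNormalCDF
  rw [gaussianReal_apply_eq_integral 0 one_ne_zero, ENNReal.toReal_ofReal]
  exact integral_nonneg (fun u => gaussianPDFReal_nonneg 0 1 u)

lemma continuous_pdf01 : Continuous (gaussianPDFReal 0 1) := by
  unfold gaussianPDFReal
  fun_prop

lemma stdNormalCDF_hasDerivAt (x : ℝ) :
    HasDerivAt stdNormalCDF (gaussianPDFReal 0 1 x) x := by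
  have hi : Integrable (gaussianPDFReal 0 1) := integrable_gaussianPDFReal 0 1
  have h : stdNormalCDF = fun y => stdNormalCDF 0 + ∫ u in (0:ℝ)..y, gaussianPDFReal 0 1 u := by
    funext y
    rw [← intervalIntegral.integral_Iic_sub_Iic hi.integrableOn hi.integrableOn,
      stdNormalCDF_eq, stdNormalCDF_eq]
    ring
  rw [h]
  exact (continuous_pdf01.integral_hasStrictDerivAt 0 x).hasDerivAt.const_add _

lemma arg_hasDerivAt (c β s : ℝ) (hs : 0 < s) :
    HasDerivAt (fun s : ℝ => (c + β * s) / Real.sqrt s)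
      ((β * s - c) / (2 * s * Real.sqrt s)) s := by
  have h1 : HasDerivAt (fun s : ℝ => c + β * s) (β * 1) s :=
    ((hasDerivAt_id s).const_mul β).const_add c
  have hq : 0 < Real.sqrt s := Real.sqrt_pos.2 hs
  have h2 := h1.div (Real.hasDerivAt_sqrt hs.ne') hq.ne'
  refine HasDerivAt.congr_deriv h2 ?_
  have h3 : Real.sqrt s ^ 2 = s := Real.sq_sqrt hs.le
  rw [h3, div_eq_div_iff (by positivity) (by positivity)]
  field_simp
  rw [h3]
  ring

lemma pdf_rel (a β s : ℝ) (hs : 0 < s) :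
    Real.exp (-2 * β * a) * gaussianPDFReal 0 1 ((-a + β * s) / Real.sqrt s)
      = gaussianPDFReal 0 1 ((a + β * s) / Real.sqrt s) := by
  unfold gaussianPDFReal
  rw [mul_left_comm, ← Real.exp_add]
  congr 2
  simp only [sub_zero, div_pow, Real.sq_sqrt hs.le, NNReal.coe_one]
  field_simp
  ring

theorem at1p_survival_strictAntiOn (a β : ℝ) (ha : 0 < a) :
    StrictAntiOn (fun s : ℝ =>
        stdNormalCDF ((a + β * s) / Real.sqrt s)
          - Real.exp (-2 * β * a) * stdNormalCDF ((-a + β * s) / Real.sqrt s))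
      (Set.Ioi (0:ℝ)) := by
  have key : ∀ s : ℝ, 0 < s → HasDerivAt (fun s : ℝ =>
        stdNormalCDF ((a + β * s) / Real.sqrt s)
          - Real.exp (-2 * β * a) * stdNormalCDF ((-a + β * s) / Real.sqrt s))
      (-(gaussianPDFReal 0 1 ((a + β * s) / Real.sqrt s) * (a / (s * Real.sqrt s)))) s := by
    intro s hs
    have h1 := (stdNormalCDF_hasDerivAt _).comp s (arg_hasDerivAt a β s hs)
    have h2 := ((stdNormalCDF_hasDerivAt _).comp s (arg_hasDerivAt (-a) β s hs)).const_mul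
      (Real.exp (-2 * β * a))
    refine HasDerivAt.congr_deriv (h1.sub h2) ?_
    rw [← mul_assoc, pdf_rel a β s hs]
    have hq : 0 < Real.sqrt s := Real.sqrt_pos.2 hs
    field_simp
    ring
  apply strictAntiOn_of_deriv_neg (convex_Ioi 0)
  · exact fun s hs => (key s hs).continuousAt.continuousWithinAt
  · intro s hs
    rw [interior_Ioi] at hs
    have hs' : 0 < s := hs
    rw [(key s hs').deriv]
    have := gaussianPDFReal_pos 0 1 ((a + β * s) / Real.sqrt s) one_ne_zero
    have hq : 0 < Real.sqrt s := Real.sqrt_pos.2 hs'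
    exact neg_neg_of_pos (by positivity)
end
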